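/- Let κ be a bounded kernel and let T be a fixed finite tree. Then the normalized embedding count s_p(T, G_n) = emb(T, G_n)/n of T in the random graph G_n = G_{1/n}(n,κ) converges in probability to s(T, κ) as n → ∞. -/

import Mathlib

open MeasureTheory Set Filter

noncomputable section
open scoped Classical

/-- `κ` is a kernel: a symmetric, measurable, nonnegative function on `[0,1]²`,
integrable on `[0,1]²`. -/
def IsKernel (κ : ℝ → ℝ → ℝ) : Prop :=
  Measurable (Function.uncurry κ) ∧ (∀ x y, κ x y = κ y x) ∧ (∀ x y, 0 ≤ κ x y) ∧
    IntegrableOn (Function.uncurry κ) (Set.Icc 0 1 ×ˢ Set.Icc 0 1)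

/-- The cube `[0,1]ᵏ`. -/
def typeCube (k : ℕ) : Set (Fin k → ℝ) := Set.univ.pi fun _ => Set.Icc (0:ℝ) 1

/-- The homomorphism density
`s(F,κ) = ∫_{[0,1]^k} ∏_{ij ∈ E(F)} κ(x_i,x_j) dx₁⋯dx_k`
of a finite graph `F` on vertex set `Fin k` in a kernel `κ`. -/
def sDensity {k : ℕ} (F : SimpleGraph (Fin k)) (κ : ℝ → ℝ → ℝ) : ℝ :=
  ∫ x in typeCube k,
    ∏ q ∈ Finset.univ.filter (fun q : Fin k × Fin k => q.1 < q.2 ∧ F.Adj q.1 q.2),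
      κ (x q.1) (x q.2)

/-- Given the vertex types `x : Fin n → ℝ`, the conditional probability that the random
graph `G_{1/n}(n,κ)` equals `G`: each pair `{i,j}` is an edge independently with
probability `min{κ(x_i,x_j)/n, 1}`. -/
def condProb (κ : ℝ → ℝ → ℝ) (n : ℕ) (x : Fin n → ℝ) (G : SimpleGraph (Fin n)) : ℝ :=
  ∏ q ∈ Finset.univ.filter (fun q : Fin n × Fin n => q.1 < q.2),
    if G.Adj q.1 q.2 then min (κ (x q.1) (x q.2) / n) 1
    else 1 - min (κ (x q.1) (x q.2) / n) 1

/-- The probability that the random graph `G_{1/n}(n,κ)` lies in a set `A` of graphs. -/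
def gProb (κ : ℝ → ℝ → ℝ) (n : ℕ) (A : Set (SimpleGraph (Fin n))) : ℝ :=
  ∫ x in typeCube n,
    ∑ G ∈ Finset.univ.filter (fun G : SimpleGraph (Fin n) => G ∈ A), condProb κ n x G

/-- `emb(F,G)`: the number of embeddings of `F` into `G`, i.e. injective maps
`φ : V(F) → V(G)` with `xy ∈ E(F) → φ(x)φ(y) ∈ E(G)`. -/
def embCount {k n : ℕ} (F : SimpleGraph (Fin k)) (G : SimpleGraph (Fin n)) : ℕ :=
  Nat.card {φ : Fin k → Fin n // Function.Injective φ ∧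
    ∀ i j, F.Adj i j → G.Adj (φ i) (φ j)}

/-- The unordered pairs of distinct elements of `V`. -/
def pairs (V : Type*) [Fintype V] : Finset (Sym2 V) :=
  Finset.univ.filter fun e => ¬ e.IsDiag

lemma mem_pairs {V : Type*} [Fintype V] {e : Sym2 V} : e ∈ pairs V ↔ ¬ e.IsDiag := by
  simp [pairs]

lemma connected_induce_range {V W : Type*} {F : SimpleGraph V} (hF : F.Connected) {H : SimpleGraph W}
    {φ : V → W} (h : ∀ i j, F.Adj i j → H.Adj (φ i) (φ j)) :
    (H.induce (Set.range φ)).Connected :=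
  hF.map (H := H.induce (Set.range φ))
    ⟨fun i => ⟨φ i, Set.mem_range_self i⟩, fun {i j} hij => h i j hij⟩
    (fun ⟨_, i, hi⟩ => ⟨i, Subtype.ext hi⟩)

section Graph

variable {V W : Type*} [Fintype V]

/-- The set of pairs onto which a map of vertices carries the edges of `F`. -/
def imageEdges (F : SimpleGraph V) (φ : V → W) : Finset (Sym2 W) :=
  F.edgeFinset.image (Sym2.map φ)

lemma mem_imageEdges {F : SimpleGraph V} {φ : V → W} {e : Sym2 W} :
    e ∈ imageEdges F φ ↔ ∃ i j, F.Adj i j ∧ s(φ i, φ j) = e := by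
  simp only [imageEdges, Finset.mem_image, SimpleGraph.mem_edgeFinset, Sym2.exists,
    SimpleGraph.mem_edgeSet, Sym2.map_mk]

lemma imageEdges_subset_iff [Fintype W] {F : SimpleGraph V} {φ : V → W} {G : SimpleGraph W} :
    imageEdges F φ ⊆ G.edgeFinset ↔ ∀ i j, F.Adj i j → G.Adj (φ i) (φ j) := by
  refine ⟨fun h i j hij => ?_, fun h e he => ?_⟩
  · simpa using h (mem_imageEdges.2 ⟨i, j, hij, rfl⟩)
  · obtain ⟨i, j, hij, rfl⟩ := mem_imageEdges.1 he
    simpa using h i j hij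

lemma imageEdges_subset_pairs [Fintype W] (F : SimpleGraph V) (φ : V ↪ W) :
    imageEdges F φ ⊆ pairs W :=
  fun e he => by
    obtain ⟨i, j, hij, rfl⟩ := mem_imageEdges.1 he
    simpa [mem_pairs] using hij.ne

lemma card_imageEdges (F : SimpleGraph V) (φ : V ↪ W) :
    (imageEdges F φ).card = F.edgeFinset.card :=
  Finset.card_image_of_injective _ (Sym2.map.injective φ.injective)

lemma prod_imageEdges (F : SimpleGraph V) (φ : V ↪ W) (p : Sym2 W → ℝ) :
    ∏ e ∈ imageEdges F φ, p e = ∏ e ∈ F.edgeFinset, p (e.map φ) :=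
  Finset.prod_image (Sym2.map.injective φ.injective).injOn

lemma disjoint_imageEdges [DecidableEq W] (F : SimpleGraph V) {φ ψ : V → W}
    (h : Disjoint (Finset.univ.image φ) (Finset.univ.image ψ)) :
    Disjoint (imageEdges F φ) (imageEdges F ψ) := by
  rw [Finset.disjoint_left]
  intro e he he'
  obtain ⟨i, j, -, rfl⟩ := mem_imageEdges.1 he
  obtain ⟨a, b, -, hab⟩ := mem_imageEdges.1 he'
  have hmem : φ i ∈ s(ψ a, ψ b) := hab ▸ Sym2.mem_mk_left _ _
  rw [Finset.disjoint_left] at h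
  rcases Sym2.mem_iff.1 hmem with h' | h'
  · exact h (Finset.mem_image_of_mem φ (Finset.mem_univ i))
      (h' ▸ Finset.mem_image_of_mem ψ (Finset.mem_univ a))
  · exact h (Finset.mem_image_of_mem φ (Finset.mem_univ i))
      (h' ▸ Finset.mem_image_of_mem ψ (Finset.mem_univ b))

/-- Two overlapping copies of a connected graph span at least one edge less than they have
vertices. -/
lemma card_image_union_le [Fintype W] [DecidableEq W] {F : SimpleGraph V}
    (hF : F.Connected) (φ ψ : V ↪ W)
    (h : ¬ Disjoint (Finset.univ.image φ) (Finset.univ.image ψ)) :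
    (Finset.univ.image φ ∪ Finset.univ.image ψ).card ≤
      (imageEdges F φ ∪ imageEdges F ψ).card + 1 := by
  set H : SimpleGraph W := SimpleGraph.fromEdgeSet (imageEdges F φ ∪ imageEdges F ψ : Set (Sym2 W))
  have hφ : (H.induce (Set.range φ)).Connected := connected_induce_range hF fun i j hij =>
    (SimpleGraph.fromEdgeSet_adj _).2
      ⟨Or.inl (mem_imageEdges.2 ⟨i, j, hij, rfl⟩), φ.injective.ne hij.ne⟩
  have hψ : (H.induce (Set.range ψ)).Connected := connected_induce_range hF fun i j hij =>
    (SimpleGraph.fromEdgeSet_adj _).2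
      ⟨Or.inr (mem_imageEdges.2 ⟨i, j, hij, rfl⟩), ψ.injective.ne hij.ne⟩
  have hne : (Set.range φ ∩ Set.range ψ).Nonempty := by
    obtain ⟨a, ha, hb⟩ := Finset.not_disjoint_iff.1 h
    exact ⟨a, by simpa using ha, by simpa using hb⟩
  have hcard := (SimpleGraph.induce_union_connected hφ.preconnected hψ.preconnected
    hne).card_vert_le_card_edgeSet_add_one
  have h1 : Nat.card ↥(Set.range φ ∪ Set.range ψ) =
      (Finset.univ.image φ ∪ Finset.univ.image ψ).card := by
    rw [Nat.card_coe_set_eq, ← Set.ncard_coe_finset]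
    simp
  have h2 : Nat.card (H.induce (Set.range φ ∪ Set.range ψ)).edgeSet ≤
      (imageEdges F φ ∪ imageEdges F ψ).card := by
    calc _ ≤ Nat.card H.edgeSet := Nat.card_le_card_of_injective _
          (SimpleGraph.Embedding.induce (G := H) (Set.range φ ∪ Set.range ψ)).mapEdgeSet.injective
      _ ≤ _ := by
        rw [Nat.card_coe_set_eq, ← Set.ncard_coe_finset]
        refine Set.ncard_le_ncard ?_ (Finset.finite_toSet _)
        rw [SimpleGraph.edgeSet_fromEdgeSet, Finset.coe_union]
        exact Set.sdiff_subset
  omega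

/-- The number of pairs of maps with images covering exactly `v` points together. -/
lemma card_pairs_card_image_union_eq_le [Fintype W] [DecidableEq W] (v : ℕ) :
    (Finset.univ.filter fun P : (V → W) × (V → W) =>
      (Finset.univ.image P.1 ∪ Finset.univ.image P.2).card = v).card ≤
    Fintype.card W ^ v * (v ^ Fintype.card V * v ^ Fintype.card V) := by
  let f : (Fin v → W) × ((V → Fin v) × (V → Fin v)) → (V → W) × (V → W) :=
    fun a => (a.1 ∘ a.2.1, a.1 ∘ a.2.2)
  calc _ ≤ (Finset.univ.image f).card := Finset.card_le_card fun P hP => ?_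
    _ ≤ (Finset.univ : Finset ((Fin v → W) × ((V → Fin v) × (V → Fin v)))).card :=
      Finset.card_image_le
    _ = _ := by simp
  let S := Finset.univ.image P.1 ∪ Finset.univ.image P.2
  have hS : S.card = v := (Finset.mem_filter.1 hP).2
  let g : S ≃ Fin v := Fintype.equivFinOfCardEq (by simpa using hS)
  refine Finset.mem_image.2 ⟨(fun i => (g.symm i : W),
    (fun i => g ⟨P.1 i, Finset.mem_union_left _ (Finset.mem_image_of_mem _ (Finset.mem_univ i))⟩,
     fun i => g ⟨P.2 i, Finset.mem_union_right _ (Finset.mem_image_of_mem _ (Finset.mem_univ i))⟩)),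
    Finset.mem_univ _, ?_⟩
  ext i <;> simp [f]

end Graph

lemma prod_lt_adj_eq_prod_edgeFinset {m : ℕ} (H : SimpleGraph (Fin m)) (f : Sym2 (Fin m) → ℝ) :
    ∏ q ∈ Finset.univ.filter (fun q : Fin m × Fin m => q.1 < q.2 ∧ H.Adj q.1 q.2),
      f s(q.1, q.2) = ∏ e ∈ H.edgeFinset, f e := by
  refine Finset.prod_bij (fun q _ => s(q.1, q.2)) ?_ ?_ ?_ ?_
  · intro q hq
    simpa using (Finset.mem_filter.1 hq).2.2
  · rintro ⟨a, b⟩ ha ⟨c, d⟩ hc h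
    have h1 := (Finset.mem_filter.1 ha).2.1
    have h2 := (Finset.mem_filter.1 hc).2.1
    simp only [Sym2.eq_iff] at h
    simp only at h1 h2
    grind
  · intro e he
    induction e with | _ a b
    have hab : H.Adj a b := by simpa using he
    rcases lt_or_gt_of_ne hab.ne with h | h
    · exact ⟨(a, b), by simp [h, hab], rfl⟩
    · exact ⟨(b, a), by simp [h, hab.symm], Sym2.eq_swap⟩
  · intros; rfl

lemma prod_lt_eq_prod_pairs {m : ℕ} (f : Sym2 (Fin m) → ℝ) :
    ∏ q ∈ Finset.univ.filter (fun q : Fin m × Fin m => q.1 < q.2), f s(q.1, q.2) =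
      ∏ e ∈ pairs (Fin m), f e := by
  have h1 : Finset.univ.filter (fun q : Fin m × Fin m => q.1 < q.2) =
      Finset.univ.filter
        (fun q : Fin m × Fin m => q.1 < q.2 ∧ (⊤ : SimpleGraph (Fin m)).Adj q.1 q.2) :=
    Finset.filter_congr fun q _ => ⟨fun hq => ⟨hq, hq.ne⟩, And.left⟩
  have h2 : pairs (Fin m) = (⊤ : SimpleGraph (Fin m)).edgeFinset := by
    ext e
    rw [mem_pairs, SimpleGraph.mem_edgeFinset, SimpleGraph.edgeSet_top]
    rfl
  rw [h1, h2]
  convert prod_lt_adj_eq_prod_edgeFinset ⊤ f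

/-- The edges in `E` are all present with probability `∏ e ∈ E, p e`. -/
lemma sum_prod_ite_mem_edgeSet {V : Type*} [Fintype V] [DecidableEq V] (p : Sym2 V → ℝ)
    {E : Finset (Sym2 V)}
    (hE : E ⊆ pairs V) :
    ∑ G : SimpleGraph V, (∏ e ∈ pairs V,
        if e ∈ G.edgeFinset then p e else 1 - p e) * (if E ⊆ G.edgeFinset then 1 else 0) =
      ∏ e ∈ E, p e := by
  set K := pairs V with hK
  have h1 : ∏ e ∈ E, p e = ∏ e ∈ K, (p e + if e ∈ E then 0 else 1 - p e) := by
    rw [← Finset.prod_subset hE fun e _ he => by simp [he]]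
    exact Finset.prod_congr rfl fun e he => by simp [he]
  have hsub (G : SimpleGraph V) : G.edgeFinset ⊆ K := fun e he =>
    mem_pairs.2 (SimpleGraph.not_isDiag_of_mem_edgeFinset he)
  rw [h1, Finset.prod_add]
  refine Finset.sum_bij (fun G _ => G.edgeFinset) (fun G _ => Finset.mem_powerset.2 (hsub G))
    (fun G _ G' _ h => SimpleGraph.edgeFinset_inj.1 h) (fun t ht => ?_) (fun G _ => ?_)
  · refine ⟨SimpleGraph.fromEdgeSet (t : Set (Sym2 V)), Finset.mem_univ _, ?_⟩
    ext e
    have : e ∈ t → ¬ e.IsDiag := fun he =>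
      mem_pairs.1 (Finset.mem_powerset.1 ht he)
    simpa using this
  · rw [Finset.prod_ite]
    have e1 : K.filter (fun e => e ∈ G.edgeFinset) = G.edgeFinset := by
      rw [Finset.filter_mem_eq_inter, Finset.inter_eq_right.2 (hsub G)]
    have e2 : K.filter (fun e => e ∉ G.edgeFinset) = K \ G.edgeFinset :=
      Finset.filter_notMem_eq_sdiff
    rw [e1, e2, mul_assoc]
    congr 1
    split_ifs with h
    · rw [mul_one]
      refine Finset.prod_congr rfl fun e he => ?_
      rw [if_neg fun h' => (Finset.mem_sdiff.1 he).2 (h h')]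
    · obtain ⟨e, he, he'⟩ := Finset.not_subset.1 h
      rw [mul_zero, Finset.prod_eq_zero (i := e) (Finset.mem_sdiff.2 ⟨hE he, he'⟩) (by simp [he])]

lemma embCount_eq_sum {k n : ℕ} (F : SimpleGraph (Fin k)) (G : SimpleGraph (Fin n)) :
    (embCount F G : ℝ) =
      ∑ φ : Fin k ↪ Fin n, if imageEdges F φ ⊆ G.edgeFinset then 1 else 0 := by
  rw [Finset.sum_boole, embCount, Nat.cast_inj, ← Fintype.card_subtype, ← Nat.card_eq_fintype_card]
  refine Nat.card_congr ⟨fun φ => ⟨⟨φ.1, φ.2.1⟩, imageEdges_subset_iff.2 φ.2.2⟩,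
    fun φ => ⟨φ.1, φ.1.injective, imageEdges_subset_iff.1 φ.2⟩, fun _ => rfl, fun _ => rfl⟩

/-- The values of the kernel `κ` on the pairs of vertices with types `x`. -/
def kernelEdge {κ : ℝ → ℝ → ℝ} (h : ∀ x y, κ x y = κ y x) {V : Type*} (x : V → ℝ) :
    Sym2 V → ℝ :=
  Sym2.lift ⟨fun i j => κ (x i) (x j), fun _ _ => h _ _⟩

/-- The probabilities of the edges of `G_{1/n}(n,κ)` given the types `x` of the vertices. -/
def edgeProb {κ : ℝ → ℝ → ℝ} (h : ∀ x y, κ x y = κ y x) (n : ℕ) {V : Type*} (x : V → ℝ)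
    (e : Sym2 V) : ℝ :=
  min (kernelEdge h x e / n) 1

section Kernel

variable {κ : ℝ → ℝ → ℝ} (h : ∀ x y, κ x y = κ y x)

lemma kernelEdge_map {V W : Type*} (x : W → ℝ) (φ : V → W) (e : Sym2 V) :
    kernelEdge h x (e.map φ) = kernelEdge h (x ∘ φ) e := by
  induction e with | _ a b
  rfl

lemma measurable_kernelEdge (hm : Measurable (Function.uncurry κ)) {V : Type*} (e : Sym2 V) :
    Measurable fun x : V → ℝ => kernelEdge h x e := by
  induction e with | _ a b
  exact hm.comp (((measurable_pi_apply a).prodMk (measurable_pi_apply b) :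
    Measurable fun x : V → ℝ => (x a, x b)))

lemma measurable_edgeProb (hm : Measurable (Function.uncurry κ)) (n : ℕ) {V : Type*}
    (e : Sym2 V) : Measurable fun x : V → ℝ => edgeProb h n x e :=
  ((measurable_kernelEdge h hm e).div_const _).min measurable_const

lemma kernelEdge_nonneg (h0 : ∀ x y, 0 ≤ κ x y) {V : Type*} (x : V → ℝ) (e : Sym2 V) :
    0 ≤ kernelEdge h x e := by
  induction e with | _ a b
  exact h0 _ _

lemma kernelEdge_le {B : ℝ} (hB : ∀ x y, κ x y ≤ B) {V : Type*} (x : V → ℝ) (e : Sym2 V) :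
    kernelEdge h x e ≤ B := by
  induction e with | _ a b
  exact hB _ _

lemma edgeProb_nonneg (h0 : ∀ x y, 0 ≤ κ x y) (n : ℕ) {V : Type*} (x : V → ℝ) (e : Sym2 V) :
    0 ≤ edgeProb h n x e :=
  le_min (div_nonneg (kernelEdge_nonneg h h0 x e) n.cast_nonneg) zero_le_one

lemma edgeProb_le_one (n : ℕ) {V : Type*} (x : V → ℝ) (e : Sym2 V) : edgeProb h n x e ≤ 1 :=
  min_le_right _ _

lemma edgeProb_eq_div {B : ℝ} (hB : ∀ x y, κ x y ≤ B) {n : ℕ} (hn : B ≤ n) (hn0 : 0 < n)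
    {V : Type*} (x : V → ℝ) (e : Sym2 V) : edgeProb h n x e = kernelEdge h x e / n := by
  refine min_eq_left ?_
  rw [div_le_one (by exact_mod_cast hn0)]
  exact (kernelEdge_le h hB x e).trans hn

lemma condProb_eq_prod (n : ℕ) (x : Fin n → ℝ) (G : SimpleGraph (Fin n)) :
    condProb κ n x G = ∏ e ∈ pairs (Fin n),
      if e ∈ G.edgeFinset then edgeProb h n x e else 1 - edgeProb h n x e := by
  rw [← prod_lt_eq_prod_pairs (fun e => if e ∈ G.edgeFinset then edgeProb h n x e
    else 1 - edgeProb h n x e), condProb]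
  refine Finset.prod_congr rfl fun q _ => ?_
  simp only [SimpleGraph.mem_edgeFinset, SimpleGraph.mem_edgeSet]
  rfl

lemma sDensity_eq_integral {k : ℕ} (F : SimpleGraph (Fin k)) :
    sDensity F κ = ∫ x in typeCube k, ∏ e ∈ F.edgeFinset, kernelEdge h x e := by
  rw [sDensity]
  simp_rw [← prod_lt_adj_eq_prod_edgeFinset]
  rfl

end Kernel

/-- Chebyshev's inequality for the embedding count, in terms of its first two moments, in the
random graph with independent edges of probabilities `p`. -/
lemma sum_filter_embCount_le {k n : ℕ} (F : SimpleGraph (Fin k)) {p : Sym2 (Fin n) → ℝ}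
    (h0 : ∀ e, 0 ≤ p e) (h1 : ∀ e, p e ≤ 1) (s : ℝ) {ε : ℝ} (hε : 0 < ε) :
    ∑ G ∈ Finset.univ.filter
        (fun G : SimpleGraph (Fin n) => G ∈ {G | ε < |(embCount F G : ℝ) / n - s|}),
      (∏ e ∈ pairs (Fin n),
        if e ∈ G.edgeFinset then p e else 1 - p e) ≤
    ((∑ P : (Fin k ↪ Fin n) × (Fin k ↪ Fin n),
        ∏ e ∈ imageEdges F P.1 ∪ imageEdges F P.2, p e) / n ^ 2
      - 2 * s * (∑ φ : Fin k ↪ Fin n, ∏ e ∈ imageEdges F φ, p e) / n + s ^ 2) / ε ^ 2 := by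
  set c : SimpleGraph (Fin n) → ℝ := fun G => ∏ e ∈ pairs (Fin n),
        if e ∈ G.edgeFinset then p e else 1 - p e with hc
  have hc0 (G) : 0 ≤ c G := Finset.prod_nonneg fun e _ => by
    split_ifs
    · exact h0 e
    · exact sub_nonneg.2 (h1 e)
  have hone : ∑ G, c G = 1 := by
    simpa [hc] using sum_prod_ite_mem_edgeSet p (E := ∅) (Finset.empty_subset _)
  have hX : ∑ G, c G * embCount F G = ∑ φ : Fin k ↪ Fin n, ∏ e ∈ imageEdges F φ, p e := by
    simp_rw [embCount_eq_sum, Finset.mul_sum]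
    rw [Finset.sum_comm]
    exact Finset.sum_congr rfl fun φ _ =>
      sum_prod_ite_mem_edgeSet p (imageEdges_subset_pairs F φ)
  have hX2 : ∑ G, c G * (embCount F G : ℝ) ^ 2 =
      ∑ P : (Fin k ↪ Fin n) × (Fin k ↪ Fin n),
        ∏ e ∈ imageEdges F P.1 ∪ imageEdges F P.2, p e := by
    have (G : SimpleGraph (Fin n)) : (embCount F G : ℝ) ^ 2 =
        ∑ P : (Fin k ↪ Fin n) × (Fin k ↪ Fin n),
          if imageEdges F P.1 ∪ imageEdges F P.2 ⊆ G.edgeFinset then 1 else 0 := by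
      rw [embCount_eq_sum, sq, Finset.sum_mul_sum, Fintype.sum_prod_type]
      simp only [Finset.union_subset_iff, ite_and, ite_mul, one_mul, zero_mul]
    simp_rw [this, Finset.mul_sum]
    rw [Finset.sum_comm]
    exact Finset.sum_congr rfl fun P _ => sum_prod_ite_mem_edgeSet p
      (Finset.union_subset (imageEdges_subset_pairs F P.1)
        (imageEdges_subset_pairs F P.2))
  have hsum : ∑ G, c G * ((embCount F G : ℝ) / n - s) ^ 2 =
      (∑ G, c G * (embCount F G : ℝ) ^ 2) / n ^ 2
        - 2 * s * (∑ G, c G * embCount F G) / n + s ^ 2 * ∑ G, c G := by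
    rw [Finset.mul_sum, Finset.mul_sum, Finset.sum_div, Finset.sum_div, ← Finset.sum_sub_distrib,
      ← Finset.sum_add_distrib]
    exact Finset.sum_congr rfl fun G _ => by ring
  rw [hX, hX2, hone, mul_one] at hsum
  rw [le_div_iff₀ (by positivity), ← hsum, Finset.sum_mul]
  refine (Finset.sum_le_sum fun G hG => ?_).trans
    (Finset.sum_le_sum_of_subset_of_nonneg (Finset.filter_subset _ _)
      fun G _ _ => mul_nonneg (hc0 G) (sq_nonneg _))
  refine mul_le_mul_of_nonneg_left ?_ (hc0 G)
  rw [← sq_abs (_ - s)]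
  exact pow_le_pow_left₀ hε.le (le_of_lt (Finset.mem_filter.1 hG).2) 2

section Integral

instance isProbabilityMeasure_restrict_Icc :
    IsProbabilityMeasure ((volume : Measure ℝ).restrict (Set.Icc 0 1)) :=
  ⟨by simp⟩

lemma volume_restrict_typeCube (k : ℕ) :
    (volume : Measure (Fin k → ℝ)).restrict (typeCube k) =
      Measure.pi fun _ => volume.restrict (Set.Icc 0 1) := by
  rw [typeCube, volume_pi, Measure.restrict_pi_pi]

lemma measurePreserving_comp_embedding {V W Ω : Type*} [Fintype V] [Fintype W]
    [MeasurableSpace Ω] (μ : Measure Ω) [IsProbabilityMeasure μ] (φ : V ↪ W) :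
    MeasurePreserving (fun x : W → Ω => x ∘ φ) (Measure.pi fun _ => μ) (Measure.pi fun _ => μ) := by
  refine ⟨measurable_pi_lambda _ fun i => measurable_pi_apply _, ?_⟩
  have hind := (ProbabilityTheory.iIndepFun_pi (μ := fun _ : W => μ) (X := fun _ => id)
    fun _ => aemeasurable_id).precomp φ.injective
  have := (ProbabilityTheory.iIndepFun_iff_map_fun_eq_pi_map
    fun i => (measurable_pi_apply (φ i)).aemeasurable).1 hind
  refine this.trans ?_
  congr 1
  ext1 i
  exact (measurePreserving_eval (fun _ : W => μ) (φ i)).map_eq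

lemma integral_comp_embedding {V W Ω : Type*} [Fintype V] [Fintype W]
    [MeasurableSpace Ω] (μ : Measure Ω) [IsProbabilityMeasure μ] (φ : V ↪ W)
    {g : (V → Ω) → ℝ} (hg : Measurable g) :
    ∫ x : W → Ω, g (x ∘ φ) ∂(Measure.pi fun _ => μ) = ∫ y, g y ∂(Measure.pi fun _ => μ) := by
  rw [← (measurePreserving_comp_embedding μ φ).map_eq,
    integral_map (measurePreserving_comp_embedding μ φ).measurable.aemeasurable
      hg.aestronglyMeasurable]

/-- Functions of disjoint families of independent coordinates are uncorrelated. -/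
lemma integral_mul_comp_embedding {V W Ω : Type*} [Fintype V] [Fintype W]
    [MeasurableSpace Ω] (μ : Measure Ω) [IsProbabilityMeasure μ] (φ ψ : V ↪ W)
    (h : ∀ i j, φ i ≠ ψ j) {g : (V → Ω) → ℝ} (hg : Measurable g) :
    ∫ x : W → Ω, g (x ∘ φ) * g (x ∘ ψ) ∂(Measure.pi fun _ => μ) =
      (∫ y, g y ∂(Measure.pi fun _ => μ)) ^ 2 := by
  let χ : V ⊕ V ↪ W := ⟨Sum.elim φ ψ, φ.injective.sumElim ψ.injective h⟩
  have hmeas (f : V → V ⊕ V) : Measurable fun y : V ⊕ V → Ω => g (y ∘ f) :=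
    hg.comp (measurable_pi_lambda _ fun i => measurable_pi_apply _)
  have h1 := integral_comp_embedding μ χ (g := fun y => g (y ∘ Sum.inl) * g (y ∘ Sum.inr))
    ((hmeas _).mul (hmeas _))
  refine h1.trans ?_
  rw [← (measurePreserving_sumPiEquivProdPi_symm (fun _ : V ⊕ V => μ)).integral_comp',
    sq, ← integral_prod_mul]
  rfl

end Integral

section Moments

variable {κ : ℝ → ℝ → ℝ} (h : ∀ x y, κ x y = κ y x)

lemma measurable_prod_kernelEdge (hm : Measurable (Function.uncurry κ)) {V : Type*}
    (E : Finset (Sym2 V)) : Measurable fun x : V → ℝ => ∏ e ∈ E, kernelEdge h x e :=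
  Finset.measurable_fun_prod _ fun e _ => measurable_kernelEdge h hm e

lemma integrableOn_prod_edgeProb (hm : Measurable (Function.uncurry κ)) (h0 : ∀ x y, 0 ≤ κ x y)
    (n : ℕ) (E : Finset (Sym2 (Fin n))) :
    IntegrableOn (fun x => ∏ e ∈ E, edgeProb h n x e) (typeCube n) := by
  rw [IntegrableOn, volume_restrict_typeCube]
  refine Integrable.of_bound (C := 1)
    (Finset.measurable_fun_prod _ fun e _ => measurable_edgeProb h hm n e).aestronglyMeasurable
    (Filter.Eventually.of_forall fun x => ?_)
  rw [Real.norm_of_nonneg (Finset.prod_nonneg fun e _ => edgeProb_nonneg h h0 n x e)]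
  exact Finset.prod_le_one (fun e _ => edgeProb_nonneg h h0 n x e)
    fun e _ => edgeProb_le_one h n x e

lemma prod_imageEdges_edgeProb {B : ℝ} (hB : ∀ x y, κ x y ≤ B) {k n : ℕ} (hn : B ≤ n)
    (hn0 : 0 < n) (F : SimpleGraph (Fin k)) (φ : Fin k ↪ Fin n) (x : Fin n → ℝ) :
    ∏ e ∈ imageEdges F φ, edgeProb h n x e =
      (∏ e ∈ F.edgeFinset, kernelEdge h (x ∘ φ) e) / n ^ F.edgeFinset.card := by
  simp_rw [prod_imageEdges, edgeProb_eq_div h hB hn hn0, kernelEdge_map, Finset.prod_div_distrib,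
    Finset.prod_const]

lemma integral_prod_imageEdges (hm : Measurable (Function.uncurry κ)) {B : ℝ}
    (hB : ∀ x y, κ x y ≤ B) {k n : ℕ} (hn : B ≤ n) (hn0 : 0 < n) (F : SimpleGraph (Fin k))
    (φ : Fin k ↪ Fin n) :
    ∫ x in typeCube n, ∏ e ∈ imageEdges F φ, edgeProb h n x e =
      sDensity F κ / n ^ F.edgeFinset.card := by
  simp_rw [prod_imageEdges_edgeProb h hB hn hn0]
  rw [integral_div, sDensity_eq_integral h, volume_restrict_typeCube, volume_restrict_typeCube,
    integral_comp_embedding _ φ (measurable_prod_kernelEdge h hm _)]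

lemma integral_prod_imageEdges_union_of_disjoint (hm : Measurable (Function.uncurry κ)) {B : ℝ}
    (hB : ∀ x y, κ x y ≤ B) {k n : ℕ} (hn : B ≤ n) (hn0 : 0 < n) (F : SimpleGraph (Fin k))
    (φ ψ : Fin k ↪ Fin n) (hd : Disjoint (Finset.univ.image φ) (Finset.univ.image ψ)) :
    ∫ x in typeCube n, ∏ e ∈ imageEdges F φ ∪ imageEdges F ψ, edgeProb h n x e =
      (sDensity F κ / n ^ F.edgeFinset.card) ^ 2 := by
  simp_rw [Finset.prod_union (disjoint_imageEdges F hd), prod_imageEdges_edgeProb h hB hn hn0,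
    div_mul_div_comm]
  rw [integral_div, sDensity_eq_integral h, volume_restrict_typeCube, volume_restrict_typeCube,
    integral_mul_comp_embedding _ φ ψ _ (measurable_prod_kernelEdge h hm _), div_pow, ← sq]
  intro i j hij
  exact Finset.disjoint_left.1 hd (Finset.mem_image_of_mem φ (Finset.mem_univ i))
    (hij ▸ Finset.mem_image_of_mem ψ (Finset.mem_univ j))

lemma integral_prod_imageEdges_union_le (h0 : ∀ x y, 0 ≤ κ x y) {C : ℝ} (hC : 1 ≤ C)
    (hB : ∀ x y, κ x y ≤ C) {k n : ℕ} (hn : C ≤ n) (hn0 : 0 < n) {F : SimpleGraph (Fin k)}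
    (hF : F.Connected) (φ ψ : Fin k ↪ Fin n)
    (hd : ¬ Disjoint (Finset.univ.image φ) (Finset.univ.image ψ)) :
    ∫ x in typeCube n, ∏ e ∈ imageEdges F φ ∪ imageEdges F ψ, edgeProb h n x e ≤
      C ^ (2 * F.edgeFinset.card) * n / n ^ (Finset.univ.image φ ∪ Finset.univ.image ψ).card := by
  set E := imageEdges F φ ∪ imageEdges F ψ
  set v := (Finset.univ.image φ ∪ Finset.univ.image ψ).card
  have hn1 : (1 : ℝ) ≤ n := by exact_mod_cast hn0
  have hEv : v ≤ E.card + 1 := card_image_union_le hF φ ψ hd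
  have hEC : E.card ≤ 2 * F.edgeFinset.card := by
    refine (Finset.card_union_le _ _).trans ?_
    rw [card_imageEdges, card_imageEdges, two_mul]
  rw [volume_restrict_typeCube]
  have hbound (x : Fin n → ℝ) :
      ∏ e ∈ E, edgeProb h n x e ≤ C ^ (2 * F.edgeFinset.card) * n / n ^ v := by
    calc ∏ e ∈ E, edgeProb h n x e ≤ ∏ _e ∈ E, C / n :=
          Finset.prod_le_prod (fun e _ => edgeProb_nonneg h h0 n x e) fun e _ => by
            rw [edgeProb_eq_div h hB hn hn0]
            gcongr
            exact kernelEdge_le h hB x e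
      _ = C ^ E.card * n / n ^ (E.card + 1) := by
          rw [Finset.prod_const, div_pow, pow_succ]
          field_simp
      _ ≤ _ := by gcongr
  refine (integral_mono_of_nonneg (Filter.Eventually.of_forall fun x =>
    Finset.prod_nonneg fun e _ => edgeProb_nonneg h h0 n x e) (integrable_const _)
    (Filter.Eventually.of_forall hbound)).trans ?_
  simp

lemma sum_div_pow_card_image_union_le {k n : ℕ} (hn0 : 0 < n) {D : ℝ} (hD : 0 ≤ D) :
    ∑ P : (Fin k ↪ Fin n) × (Fin k ↪ Fin n),
      D / (n : ℝ) ^ (Finset.univ.image P.1 ∪ Finset.univ.image P.2).card ≤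
    ∑ v ∈ Finset.range (2 * k + 1), D * ((v : ℝ) ^ k * (v : ℝ) ^ k) := by
  have hn : (0 : ℝ) < n := by exact_mod_cast hn0
  rw [← Finset.sum_fiberwise_of_maps_to (t := Finset.range (2 * k + 1))
    (g := fun P : (Fin k ↪ Fin n) × (Fin k ↪ Fin n) =>
      (Finset.univ.image P.1 ∪ Finset.univ.image P.2).card)]
  · refine Finset.sum_le_sum fun v _ => ?_
    rw [Finset.sum_congr rfl (g := fun _ => D / (n : ℝ) ^ v)
      fun P hP => by rw [(Finset.mem_filter.1 hP).2], Finset.sum_const, nsmul_eq_mul]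
    have hcard : (Finset.univ.filter fun P : (Fin k ↪ Fin n) × (Fin k ↪ Fin n) =>
        (Finset.univ.image P.1 ∪ Finset.univ.image P.2).card = v).card ≤
        n ^ v * (v ^ k * v ^ k) := by
      have := card_pairs_card_image_union_eq_le (V := Fin k) (W := Fin n) v
      simp only [Fintype.card_fin] at this
      refine (Finset.card_le_card_of_injOn 
        (fun P : (Fin k ↪ Fin n) × (Fin k ↪ Fin n) => (⇑P.1, ⇑P.2)) (fun P hP => ?_) ?_).trans this
      · simpa using hP
      · rintro ⟨a, b⟩ - ⟨c, d⟩ - hac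
        simpa using hac
    calc _ ≤ ((n : ℝ) ^ v * ((v : ℝ) ^ k * (v : ℝ) ^ k)) * (D / (n : ℝ) ^ v) := by
          gcongr
          exact_mod_cast hcard
      _ = _ := by field_simp
  · intro P _
    rw [Finset.mem_range, Nat.lt_succ_iff]
    refine (Finset.card_union_le _ _).trans ?_
    rw [two_mul]
    exact add_le_add (Finset.card_image_le.trans (by simp)) (Finset.card_image_le.trans (by simp))

/-- The second moment of the embedding count of a tree is at most `n² s(T,κ)² + O(n)`. -/
lemma sum_integral_prod_imageEdges_union_le (hm : Measurable (Function.uncurry κ))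
    (h0 : ∀ x y, 0 ≤ κ x y) {C : ℝ} (hC : 1 ≤ C) (hB : ∀ x y, κ x y ≤ C) {k n : ℕ} (hn : C ≤ n)
    (hn0 : 0 < n) {T : SimpleGraph (Fin k)} (hT : T.IsTree) :
    ∑ P : (Fin k ↪ Fin n) × (Fin k ↪ Fin n),
      ∫ x in typeCube n, ∏ e ∈ imageEdges T P.1 ∪ imageEdges T P.2, edgeProb h n x e ≤
    n ^ 2 * sDensity T κ ^ 2 +
      (∑ v ∈ Finset.range (2 * k + 1),
        C ^ (2 * T.edgeFinset.card) * ((v : ℝ) ^ k * (v : ℝ) ^ k)) * n := by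
  have hn' : (0 : ℝ) < n := by exact_mod_cast hn0
  have hk : T.edgeFinset.card + 1 = k := by simpa using hT.card_edgeFinset
  have hC0 : 0 ≤ C := zero_le_one.trans hC
  calc _ ≤ ∑ P : (Fin k ↪ Fin n) × (Fin k ↪ Fin n),
        ((sDensity T κ / n ^ T.edgeFinset.card) ^ 2 +
          C ^ (2 * T.edgeFinset.card) * n /
            n ^ (Finset.univ.image P.1 ∪ Finset.univ.image P.2).card) := by
        refine Finset.sum_le_sum fun P _ => ?_
        by_cases hd : Disjoint (Finset.univ.image P.1) (Finset.univ.image P.2)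
        · rw [integral_prod_imageEdges_union_of_disjoint h hm hB hn hn0 T P.1 P.2 hd]
          exact le_add_of_nonneg_right (by positivity)
        · exact (integral_prod_imageEdges_union_le h h0 hC hB hn hn0 hT.connected P.1 P.2
            hd).trans (le_add_of_nonneg_left (by positivity))
    _ ≤ (n : ℝ) ^ (2 * k) * (sDensity T κ / n ^ T.edgeFinset.card) ^ 2 +
        ∑ v ∈ Finset.range (2 * k + 1),
          C ^ (2 * T.edgeFinset.card) * n * ((v : ℝ) ^ k * (v : ℝ) ^ k) := by
        rw [Finset.sum_add_distrib, Finset.sum_const, nsmul_eq_mul]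
        gcongr
        · rw [Finset.card_univ, Fintype.card_prod, Fintype.card_embedding_eq, two_mul, pow_add]
          push_cast
          have : ((n.descFactorial k : ℕ) : ℝ) ≤ (n : ℝ) ^ k := by
            exact_mod_cast Nat.descFactorial_le_pow n k
          simp only [Fintype.card_fin]
          gcongr
        · exact sum_div_pow_card_image_union_le hn0 (by positivity)
    _ = _ := by
        rw [Finset.sum_mul]
        congr 1
        · have hpow : (n : ℝ) ^ k = n ^ T.edgeFinset.card * n := by rw [← pow_succ, hk]
          rw [two_mul k, pow_add, hpow]
          field_simp
        · exact Finset.sum_congr rfl fun v _ => by ring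

end Moments

/-- Let `κ` be a bounded kernel and `T` a fixed finite tree (a finite
connected acyclic graph).  Then the normalized embedding count
`s_p(T, G_n) = emb(T, G_n)/n` in `G_n = G_{1/n}(n,κ)` converges in probability to
`s(T,κ)`: for every `ε > 0`, the probability that `|emb(T,G_n)/n − s(T,κ)| > ε`
tends to `0` as `n → ∞`. -/
theorem normalized_tree_embedding_count_tendsto_in_probability
    (κ : ℝ → ℝ → ℝ) (hκ : IsKernel κ) (hbdd : ∃ B : ℝ, ∀ x y, κ x y ≤ B)
    {k : ℕ} (T : SimpleGraph (Fin k)) (hTconn : T.Connected) (hTacyc : T.IsAcyclic) :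
    ∀ ε : ℝ, 0 < ε →
      Tendsto (fun n : ℕ =>
          gProb κ n {G | ε < |(embCount T G : ℝ) / n - sDensity T κ|})
        atTop (nhds 0) := by
  intro ε hε
  obtain ⟨hm, h, h0, -⟩ := hκ
  obtain ⟨B, hB⟩ := hbdd
  have hT : T.IsTree := ⟨hTconn, hTacyc⟩
  have hk : T.edgeFinset.card + 1 = k := by simpa using hT.card_edgeFinset
  set C : ℝ := max B 1
  have hC : ∀ x y, κ x y ≤ C := fun x y => (hB x y).trans (le_max_left _ _)
  set s := sDensity T κ
  set K : ℝ := ∑ v ∈ Finset.range (2 * k + 1),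
    C ^ (2 * T.edgeFinset.card) * ((v : ℝ) ^ k * (v : ℝ) ^ k)
  have hnonneg (n : ℕ) (x : Fin n → ℝ) (G : SimpleGraph (Fin n)) : 0 ≤ condProb κ n x G := by
    rw [condProb_eq_prod h]
    refine Finset.prod_nonneg fun e _ => ?_
    split_ifs
    · exact edgeProb_nonneg h h0 n x e
    · exact sub_nonneg.2 (edgeProb_le_one h n x e)
  have hlim : Tendsto (fun n : ℕ =>
      (s ^ 2 + K / n - 2 * s ^ 2 * ((n.descFactorial k : ℝ) / (n : ℝ) ^ k) + s ^ 2) / ε ^ 2)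
      atTop (nhds 0) := by
    have h1 : Tendsto (fun n : ℕ => (n.descFactorial k : ℝ) / (n : ℝ) ^ k) atTop (nhds 1) := by
      refine (Asymptotics.isEquivalent_iff_tendsto_one ?_).1 (isEquivalent_descFactorial k)
      filter_upwards [eventually_gt_atTop 0] with n hn
      positivity
    have h2 := ((((tendsto_const_div_atTop_nhds_zero_nat K).const_add (s ^ 2)).sub
      (h1.const_mul (2 * s ^ 2))).add_const (s ^ 2)).div_const (ε ^ 2)
    convert h2 using 2
    ring
  refine squeeze_zero' (Eventually.of_forall fun n =>
    integral_nonneg fun x => Finset.sum_nonneg fun G _ => hnonneg n x G) ?_ hlim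
  filter_upwards [eventually_ge_atTop ⌈C⌉₊, eventually_gt_atTop 0] with n hn hn0
  have hCn : C ≤ n := Nat.ceil_le.1 hn
  have hn' : (0 : ℝ) < n := by exact_mod_cast hn0
  have hint (E : Finset (Sym2 (Fin n))) := integrableOn_prod_edgeProb h hm h0 n E
  have hint1 : IntegrableOn (fun x => ∑ φ : Fin k ↪ Fin n,
      ∏ e ∈ imageEdges T φ, edgeProb h n x e) (typeCube n) :=
    integrable_finsetSum _ fun φ _ => hint _
  have hint2 : IntegrableOn (fun x => ∑ P : (Fin k ↪ Fin n) × (Fin k ↪ Fin n),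
      ∏ e ∈ imageEdges T P.1 ∪ imageEdges T P.2, edgeProb h n x e) (typeCube n) :=
    integrable_finsetSum _ fun P _ => hint _
  have hint3 : IntegrableOn (fun x => (∑ P : (Fin k ↪ Fin n) × (Fin k ↪ Fin n),
      ∏ e ∈ imageEdges T P.1 ∪ imageEdges T P.2, edgeProb h n x e) / n ^ 2
        - 2 * s * (∑ φ : Fin k ↪ Fin n, ∏ e ∈ imageEdges T φ, edgeProb h n x e) / n)
      (typeCube n) :=
    (hint2.div_const _).sub ((hint1.const_mul _).div_const _)
  have hone : (volume.restrict (typeCube n)).real Set.univ = 1 := by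
    rw [volume_restrict_typeCube]
    simp
  have : IsFiniteMeasure ((volume : Measure (Fin n → ℝ)).restrict (typeCube n)) := by
    rw [volume_restrict_typeCube]
    infer_instance
  calc gProb κ n {G | ε < |(embCount T G : ℝ) / n - s|}
      ≤ ∫ x in typeCube n,
        ((∑ P : (Fin k ↪ Fin n) × (Fin k ↪ Fin n),
          ∏ e ∈ imageEdges T P.1 ∪ imageEdges T P.2, edgeProb h n x e) / n ^ 2
        - 2 * s * (∑ φ : Fin k ↪ Fin n, ∏ e ∈ imageEdges T φ, edgeProb h n x e) / n
          + s ^ 2) / ε ^ 2 := by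
        refine integral_mono_of_nonneg (Eventually.of_forall fun x =>
          Finset.sum_nonneg fun G _ => hnonneg n x G)
          ((hint3.add (integrable_const _)).div_const _) (Eventually.of_forall fun x => ?_)
        simp_rw [condProb_eq_prod h]
        exact sum_filter_embCount_le T (edgeProb_nonneg h h0 n x) (edgeProb_le_one h n x) s hε
    _ = ((∑ P : (Fin k ↪ Fin n) × (Fin k ↪ Fin n),
          ∫ x in typeCube n, ∏ e ∈ imageEdges T P.1 ∪ imageEdges T P.2, edgeProb h n x e) / n ^ 2
        - 2 * s * (∑ φ : Fin k ↪ Fin n,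
          ∫ x in typeCube n, ∏ e ∈ imageEdges T φ, edgeProb h n x e) / n + s ^ 2) / ε ^ 2 := by
        rw [integral_div, integral_add hint3 (integrable_const _),
          integral_sub (hint2.div_const _) ((hint1.const_mul _).div_const _), integral_div,
          integral_div, integral_const_mul, integral_finsetSum _ fun φ _ => hint _,
          integral_finsetSum _ fun φ _ => hint _, integral_const, hone, one_smul]
    _ ≤ ((n ^ 2 * s ^ 2 + K * n) / n ^ 2
        - 2 * s * (n.descFactorial k * (s / n ^ T.edgeFinset.card)) / n + s ^ 2) / ε ^ 2 := by
        simp_rw [integral_prod_imageEdges h hm hC hCn hn0 T]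
        rw [Finset.sum_const, nsmul_eq_mul, Finset.card_univ, Fintype.card_embedding_eq,
          Fintype.card_fin, Fintype.card_fin]
        gcongr
        exact sum_integral_prod_imageEdges_union_le h hm h0 (le_max_right _ _) hC hCn hn0 hT
    _ = _ := by
        have hpow : (n : ℝ) ^ k = n ^ T.edgeFinset.card * n := by rw [← pow_succ, hk]
        rw [hpow]
        field_simp
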